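/- Let (Q,·,\,1) be a uniquely 2-divisible commutative automorphic loop and let a ∈ Q satisfy P_a(P_x(y)) = P_x(P_a(y)) for all x,y ∈ Q (i.e., a lies in the center of the associated Bruck loop). Then for all x ∈ Q, x⁻¹·P_a(x) = a·a; explicitly, x⁻¹·( a⁻¹ \ (a·x) ) = a·a. -/

import Mathlib

/-- A commutative automorphic loop, presented by its multiplication and left division. -/
structure CommAutomorphicLoop (Q : Type*) where
  mul : Q → Q → Q
  ld : Q → Q → Q
  one : Q
  ld_mul : ∀ x y, ld x (mul x y) = y
  mul_ld : ∀ x y, mul x (ld x y) = y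
  one_mul : ∀ x, mul one x = x
  mul_one : ∀ x, mul x one = x
  comm : ∀ x y, mul x y = mul y x
  auto : ∀ x y u v, ld (mul y x) (mul y (mul x (mul u v))) =
    mul (ld (mul y x) (mul y (mul x u))) (ld (mul y x) (mul y (mul x v)))

namespace CommAutomorphicLoop

variable {Q : Type*} (S : CommAutomorphicLoop Q)

/-- The inverse `x \ 1`. -/
def inv (x : Q) : Q := S.ld x S.one

/-- Translations as permutations. -/
def L (x : Q) : Equiv.Perm Q where
  toFun := S.mul x
  invFun := S.ld x
  left_inv := S.ld_mul x
  right_inv := S.mul_ld x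

/-- The permutation `P_x` of the associated Bruck loop. -/
def P (x : Q) : Equiv.Perm Q := (S.L (S.inv x))⁻¹ * S.L x

/-- The inner mapping `L_{x,y}`. -/
def inner (x y : Q) : Equiv.Perm Q := (S.L (S.mul y x))⁻¹ * (S.L y * S.L x)

/-- Multiplicative permutations. -/
def IsAut (φ : Equiv.Perm Q) : Prop := ∀ u v, φ (S.mul u v) = S.mul (φ u) (φ v)

/-- Elements `a` such that `P_a` commutes with every `P_x`. -/
def BruckCentral (a : Q) : Prop := ∀ x, Commute (S.P a) (S.P x)

theorem L_apply (x y : Q) : S.L x y = S.mul x y := rfl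

theorem L_inv_apply (x y : Q) : (S.L x)⁻¹ y = S.ld x y := rfl

theorem mul_inv (x : Q) : S.mul x (S.inv x) = S.one := S.mul_ld x S.one

theorem mul_left_cancel {x y z : Q} (h : S.mul x y = S.mul x z) : y = z :=
  (S.L x).injective h

theorem eq_inv_of_mul_eq_one {x y : Q} (h : S.mul x y = S.one) : y = S.inv x :=
  S.mul_left_cancel (h.trans (S.mul_inv x).symm)

theorem inv_inv (x : Q) : S.inv (S.inv x) = x :=
  (S.eq_inv_of_mul_eq_one ((S.comm _ _).trans (S.mul_inv x))).symm

theorem inv_one : S.inv S.one = S.one := (S.eq_inv_of_mul_eq_one (S.mul_one _)).symm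

theorem L_one : S.L S.one = 1 := Equiv.ext S.one_mul

theorem isAut_inner (x y : Q) : S.IsAut (S.inner x y) := S.auto x y

variable {S}

theorem IsAut.inv {φ : Equiv.Perm Q} (h : S.IsAut φ) : S.IsAut φ⁻¹ := fun u v => by
  apply φ.injective
  rw [h]
  simp

theorem IsAut.map_one {φ : Equiv.Perm Q} (h : S.IsAut φ) : φ S.one = S.one := by
  apply S.mul_left_cancel (x := φ S.one)
  rw [← h, S.mul_one, S.mul_one]

theorem IsAut.map_inv {φ : Equiv.Perm Q} (h : S.IsAut φ) (x : Q) :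
    φ (S.inv x) = S.inv (φ x) :=
  S.eq_inv_of_mul_eq_one (by rw [← h, S.mul_inv, h.map_one])

theorem IsAut.mul_L {φ : Equiv.Perm Q} (h : S.IsAut φ) (x : Q) :
    φ * S.L x = S.L (φ x) * φ := Equiv.ext (h x)

theorem IsAut.conj_L {φ : Equiv.Perm Q} (h : S.IsAut φ) (x : Q) :
    φ * S.L x * φ⁻¹ = S.L (φ x) := by
  rw [h.mul_L, mul_inv_cancel_right]

theorem IsAut.conj_P {φ : Equiv.Perm Q} (h : S.IsAut φ) (x : Q) :
    φ * S.P x * φ⁻¹ = S.P (φ x) := by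
  rw [P, P, ← h.map_inv, ← h.conj_L, ← h.conj_L]
  group

theorem BruckCentral.map {a : Q} (ha : S.BruckCentral a) {φ : Equiv.Perm Q} (h : S.IsAut φ) :
    S.BruckCentral (φ a) := fun x => by
  have hx : φ (φ⁻¹ x) = x := by simp
  rw [← hx, ← h.conj_P, ← h.conj_P, Commute, SemiconjBy, ← MulAut.conj_apply,
    ← MulAut.conj_apply, ← map_mul, ← map_mul, (ha _).eq]

variable (S)

theorem L_mul_inner (x y : Q) : S.L (S.mul y x) * S.inner x y = S.L y * S.L x := by
  rw [inner, mul_inv_cancel_left]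

theorem isAut_L_inv_mul_L (x : Q) : S.IsAut (S.L (S.inv x) * S.L x) := by
  have h := S.isAut_inner x (S.inv x)
  rwa [inner, S.comm, S.mul_inv, L_one, _root_.inv_one, _root_.one_mul] at h

theorem commute_L_L_inv (x : Q) : Commute (S.L x) (S.L (S.inv x)) := by
  have h := (S.isAut_L_inv_mul_L x).mul_L (S.inv x)
  have hx : (S.L (S.inv x) * S.L x) (S.inv x) = S.inv x := by
    rw [Equiv.Perm.mul_apply, L_apply, L_apply, S.mul_inv, S.mul_one]
  rw [hx, mul_assoc, mul_right_inj] at h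
  exact h

/-- The automorphic inverse property. -/
theorem inv_mul (x y : Q) : S.inv (S.mul y x) = S.mul (S.inv y) (S.inv x) := by
  set w := S.mul y x with hw
  set v := S.ld w y with hv
  have hwv : S.mul w v = y := S.mul_ld w y
  have haut := S.isAut_inner v w
  have hφ : ∀ z, S.inner v w z = S.ld y (S.mul w (S.mul v z)) := fun z => by
    simp only [inner, hwv]; rfl
  have h1 : S.inner v w v = S.inv x := by
    have h := haut.map_inv (S.inv v)
    rwa [S.inv_inv, hφ (S.inv v), S.mul_inv, S.mul_one, hw, S.ld_mul] at h
  have h2 : S.inner v w w = w := by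
    rw [hφ, S.comm v w, hwv, S.comm w y, S.ld_mul]
  have h3 : S.inner v w (S.ld v (S.inv w)) = S.inv y := by
    rw [hφ, S.mul_ld, S.mul_inv]; rfl
  rw [← h1, ← h3, ← haut, S.comm, S.mul_ld, haut.map_inv, h2]

theorem inner_inv_inv (x y : Q) : S.inner (S.inv x) (S.inv y) = S.inner x y := by
  ext z
  apply S.mul_left_cancel (x := S.mul (S.inv y) (S.inv x))
  have h := congrArg S.inv (Equiv.congr_fun (S.L_mul_inner x y) (S.inv z))
  simp only [Equiv.Perm.mul_apply, L_apply, inv_mul, S.inv_inv] at h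
  rw [← (S.isAut_inner x y).map_inv, S.inv_inv] at h
  rw [h]
  exact Equiv.congr_fun (S.L_mul_inner (S.inv x) (S.inv y)) z

theorem L_inv_mul_P (x : Q) : S.L (S.inv x) * S.P x = S.L x := mul_inv_cancel_left _ _

theorem commute_P_L_inv (x : Q) : Commute (S.P x) (S.L (S.inv x)) :=
  (Commute.inv_left (Commute.refl _)).mul_left (S.commute_L_L_inv x)

theorem P_mul_L_inv (x : Q) : S.P x * S.L (S.inv x) = S.L x := by
  rw [(S.commute_P_L_inv x).eq, L_inv_mul_P]

theorem P_inv (x : Q) : S.P (S.inv x) = (S.P x)⁻¹ := by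
  rw [P, S.inv_inv, P, _root_.mul_inv_rev, _root_.inv_inv]

theorem P_mul (x y : Q) : S.P (S.mul y x) = S.L y * S.P x * (S.L (S.inv y))⁻¹ := by
  have h1 := S.L_mul_inner x y
  have h2 := S.L_mul_inner (S.inv x) (S.inv y)
  rw [inner_inv_inv, ← inv_mul] at h2
  rw [← mul_inv_eq_iff_eq_mul.mpr (S.P_mul_L_inv (S.mul y x)).symm,
    ← mul_inv_eq_iff_eq_mul.mpr (S.P_mul_L_inv x).symm,
    eq_mul_inv_of_mul_eq h1, eq_mul_inv_of_mul_eq h2]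
  group

theorem P_mul_self (x : Q) : S.P (S.mul x x) = S.P x ^ 2 := by
  rw [P_mul, ← P_mul_L_inv, mul_assoc (S.P x), ← (S.commute_P_L_inv x).eq, sq]
  group

theorem P_one_apply (x : Q) : S.P x S.one = S.mul x x := by
  have h := Equiv.congr_fun (S.commute_L_L_inv x) x
  rw [Equiv.Perm.mul_apply, Equiv.Perm.mul_apply, L_apply, L_apply, L_apply, L_apply,
    S.comm (S.inv x), S.mul_inv, S.mul_one] at h
  rw [P, Equiv.Perm.mul_apply, Equiv.Perm.inv_eq_iff_eq, L_apply, L_apply, S.mul_one]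
  exact h

theorem P_mul_eq_P_mul_conj (x y : Q) :
    S.P (S.mul y x) = S.P y * (S.L (S.inv y) * S.P x * (S.L (S.inv y))⁻¹) := by
  rw [P_mul, ← P_mul_L_inv]
  group

variable {S}

theorem BruckCentral.conj_P_sq {a : Q} (ha : S.BruckCentral a) (y : Q) :
    (S.L (S.inv y) * S.P a * (S.L (S.inv y))⁻¹) ^ 2 = S.P a ^ 2 := by
  have h1 := S.P_mul_eq_P_mul_conj a y
  have h2 := S.P_mul_eq_P_mul_conj (S.inv a) y
  rw [S.comm, P_mul_eq_P_mul_conj] at h1 h2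
  have hconj : S.L a * S.P y * (S.L a)⁻¹ =
      S.L (S.inv a) * S.P y * (S.L (S.inv a))⁻¹ := by
    rw [← S.L_inv_mul_P a, mul_assoc (S.L _), (ha y).eq]
    group
  rw [S.inv_inv, P_inv, hconj] at h2
  set M := S.L (S.inv y) * S.P a * (S.L (S.inv y))⁻¹ with hM
  have hM' : S.L (S.inv y) * (S.P a)⁻¹ * (S.L (S.inv y))⁻¹ = M⁻¹ := by
    rw [hM]
    group
  rw [hM', inv_mul_eq_iff_eq_mul] at h2
  rw [h2, ← mul_assoc, ← mul_assoc, ← sq, ((ha y).pow_left 2).eq, mul_assoc] at h1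
  have h3 := _root_.mul_left_cancel h1
  rw [sq M, ← mul_inv_eq_iff_eq_mul.mp h3]

/-- Conjugation by `L_{y⁻¹}`, with `y` a square, preserves the set of central `P_a`. -/
theorem BruckCentral.exists_conj_P {a : Q} (ha : S.BruckCentral a) (r : Q) :
    ∃ c, S.L (S.inv (S.mul r r)) * S.P a * (S.L (S.inv (S.mul r r)))⁻¹ = S.P c := by
  set θ := S.inner (S.inv r) (S.inv r) with hθ_def
  have hθ : S.IsAut θ⁻¹ := (S.isAut_inner _ _).inv
  refine ⟨(S.L (S.inv r) * S.L r) (θ⁻¹ a), ?_⟩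
  have hL : S.L (S.inv (S.mul r r)) = S.L (S.inv r) * S.L r * (S.P r)⁻¹ * θ⁻¹ := by
    rw [inv_mul, eq_mul_inv_of_mul_eq (S.L_mul_inner (S.inv r) (S.inv r)), ← S.L_inv_mul_P r,
      ← hθ_def]
    group
  have hP : (S.P r)⁻¹ * S.P (θ⁻¹ a) * S.P r = S.P (θ⁻¹ a) := by
    rw [mul_assoc, ((ha.map hθ) r).eq, inv_mul_cancel_left]
  rw [← (S.isAut_L_inv_mul_L r).conj_P, ← hP, ← hθ.conj_P, hL]
  group

theorem BruckCentral.conj_P (hsq : Function.Bijective fun x => S.mul x x) {a : Q}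
    (ha : S.BruckCentral a) (y : Q) :
    S.L (S.inv y) * S.P a * (S.L (S.inv y))⁻¹ = S.P a := by
  obtain ⟨r, rfl⟩ := hsq.surjective y
  obtain ⟨c, hc⟩ := ha.exists_conj_P r
  have h := ha.conj_P_sq (S.mul r r)
  rw [hc, ← P_mul_self, ← P_mul_self] at h
  have h1 := Equiv.congr_fun h S.one
  rw [P_one_apply, P_one_apply] at h1
  rw [hc, hsq.injective (hsq.injective h1)]

theorem BruckCentral.inv_mul_P_apply (hsq : Function.Bijective fun x => S.mul x x) {a : Q}
    (ha : S.BruckCentral a) (x : Q) : S.mul (S.inv x) (S.P a x) = S.mul a a := by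
  have h := Equiv.congr_fun (ha.conj_P hsq x) S.one
  rw [P_one_apply, Equiv.Perm.mul_apply, Equiv.Perm.mul_apply, L_inv_apply] at h
  change S.mul _ (S.P a (S.inv (S.inv x))) = _ at h
  rwa [S.inv_inv] at h

end CommAutomorphicLoop

/-- **Lemma 4.2, equation (4.5).** In a uniquely 2-divisible commutative automorphic
loop, if `a` lies in the center of the associated Bruck loop (i.e. `P_a P_x = P_x P_a`
for all `x`, where `x⁻¹ := x \ 1` and `P_x(y) := x⁻¹ \ (x·y)`), then
`x⁻¹ · P_a(x) = a²` for all `x`. -/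
theorem bruck_central_xinv_mul_P_a_x_eq_a_sq
    (Q : Type) (mul ld : Q → Q → Q) (one : Q)
    (hld1 : ∀ x y : Q, ld x (mul x y) = y)
    (hld2 : ∀ x y : Q, mul x (ld x y) = y)
    (hone1 : ∀ x : Q, mul one x = x)
    (hone2 : ∀ x : Q, mul x one = x)
    (hcomm : ∀ x y : Q, mul x y = mul y x)
    (hauto : ∀ x y u v : Q,
      ld (mul y x) (mul y (mul x (mul u v))) =
        mul (ld (mul y x) (mul y (mul x u))) (ld (mul y x) (mul y (mul x v))))
    (hsq : Function.Bijective (fun x : Q => mul x x))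
    (a : Q)
    (ha : ∀ x y : Q, ld (ld a one) (mul a (ld (ld x one) (mul x y))) =
      ld (ld x one) (mul x (ld (ld a one) (mul a y)))) :
    ∀ x : Q, mul (ld x one) (ld (ld a one) (mul a x)) = mul a a := by
  let S : CommAutomorphicLoop Q := ⟨mul, ld, one, hld1, hld2, hone1, hone2, hcomm, hauto⟩
  have hS : S.BruckCentral a := fun x => Equiv.ext (ha x)
  exact hS.inv_mul_P_apply hsq
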